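/- Let n ≥ 1 and let L ⊂ ℝ^n be the set of unit vectors with all coordinates nonnegative. Let γ : [0,∞) → L be any continuous path. Then there exists a walk c : [0,∞) → ℝ^n over V = {e_1,…,e_n} with c(0) = 0, ‖c(t)‖ → ∞ as t → ∞, and whose radial limit set equals the intersection over all T > 0 of the closures of γ([T,∞)). -/

import Mathlib

open Filter

/-- A walk over a finite family of vectors `v : Fin m → ℝ^n`. -/
def IsWalk {n m : ℕ} (v : Fin m → EuclideanSpace ℝ (Fin n))
    (c : ℝ → EuclideanSpace ℝ (Fin n)) : Prop :=
  ∃ j : ℕ → Fin m, ∀ k : ℕ, ∀ t ∈ Set.Icc (k : ℝ) ((k : ℝ) + 1),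
    c t = c (k : ℝ) + (t - (k : ℝ)) • v (j k)

/-- The radial limit set of a path `c`. -/
def radialLimitSet {n : ℕ} (c : ℝ → EuclideanSpace ℝ (Fin n)) :
    Set (EuclideanSpace ℝ (Fin n)) :=
  {q | ∃ a : ℕ → ℝ, (∀ k, 0 ≤ a k) ∧ Tendsto a atTop atTop ∧
    Tendsto (fun k => ‖c (a k)‖⁻¹ • c (a k)) atTop (nhds q)}

open Topology

/-- A continuous path on `[0,∞)` can be sampled along a sequence of times going to infinity so
that its oscillation between consecutive samples tends to zero. -/
lemma exists_sampling {X : Type*} [PseudoMetricSpace X] {f : ℝ → X}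
    (hf : ContinuousOn f (Set.Ici 0)) :
    ∃ s : ℕ → ℝ, s 0 = 0 ∧ Monotone s ∧ Tendsto s atTop atTop ∧
      ∀ ε > 0, ∀ᶠ m in atTop, ∀ t ∈ Set.Icc (s m) (s (m + 1)), dist (f t) (f (s m)) < ε := by
  have key : ∀ N : ℕ, ∃ δ : ℝ, 0 < δ ∧ δ ≤ 1 ∧ ∀ a ∈ Set.Icc (0 : ℝ) (N + 2),
      ∀ b ∈ Set.Icc (0 : ℝ) (N + 2), dist a b ≤ δ → dist (f a) (f b) < 1 / ((N : ℝ) + 1) := by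
    intro N
    have huc : UniformContinuousOn f (Set.Icc (0 : ℝ) (N + 2)) :=
      isCompact_Icc.uniformContinuousOn_of_continuous (hf.mono fun x hx => hx.1)
    obtain ⟨δ, hδ, h⟩ := Metric.uniformContinuousOn_iff.1 huc (1 / ((N : ℝ) + 1)) (by positivity)
    refine ⟨min (δ / 2) 1, by positivity, min_le_right _ _, fun a ha b hb hab => h a ha b hb ?_⟩
    have := min_le_left (δ / 2) 1
    linarith
  choose δ hδ0 hδ1 hδ using key
  let s : ℕ → ℝ := fun m => Nat.rec 0 (fun _ x => x + δ ⌊x⌋₊) m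
  have hs : ∀ m, s (m + 1) = s m + δ ⌊s m⌋₊ := fun m => rfl
  have hmono : Monotone s := monotone_nat_of_le_succ fun m => by
    rw [hs]; linarith [hδ0 ⌊s m⌋₊]
  have hs0 : ∀ m, 0 ≤ s m := fun m => hmono (Nat.zero_le m)
  have htend : Tendsto s atTop atTop := by
    refine tendsto_atTop_atTop_of_monotone hmono fun B => ?_
    by_contra! hB
    obtain ⟨N, -, hN⟩ := Finset.exists_min_image (Finset.range (⌊B⌋₊ + 1)) δ ⟨0, by simp⟩
    have hstep : ∀ m : ℕ, m * δ N ≤ s m := by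
      intro m
      induction m with
      | zero => simp [s]
      | succ m ih =>
        have h1 : ⌊s m⌋₊ ≤ ⌊B⌋₊ := Nat.floor_mono (hB m).le
        have h2 := hN ⌊s m⌋₊ (Finset.mem_range.2 (by omega))
        rw [hs]; push_cast; linarith
    obtain ⟨m, hm⟩ := exists_nat_gt (B / δ N)
    rw [div_lt_iff₀ (hδ0 N)] at hm
    linarith [hstep m, hB m]
  refine ⟨s, rfl, hmono, htend, fun ε hε => ?_⟩
  have hev := (tendsto_one_div_add_atTop_nhds_zero_nat (𝕜 := ℝ)).comp
    (tendsto_nat_floor_atTop.comp htend)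
  filter_upwards [hev.eventually (gt_mem_nhds hε)] with m hm t ht
  have h1 := Nat.lt_floor_add_one (s m)
  have h2 := hδ1 ⌊s m⌋₊
  have h3 := ht.2
  rw [hs] at h3
  refine (hδ ⌊s m⌋₊ t ⟨(hs0 m).trans ht.1, by linarith⟩ (s m)
    ⟨hs0 m, by linarith⟩ ?_).trans hm
  rw [Real.dist_eq, abs_of_nonneg (by linarith [ht.1])]
  linarith

/-- Adding a suitable basis vector to `p` keeps it close to the ray through a point `x` of the
standard simplex. -/
lemma exists_greedy_step {n : ℕ} [Nonempty (Fin n)] (a : ℝ) (x p : EuclideanSpace ℝ (Fin n)) :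
    ∃ j : Fin n, (∀ i, 0 ≤ x i) → ∑ i, x i = 1 →
      ‖(a + 1) • x - (p + EuclideanSpace.single j (1 : ℝ))‖ ^ 2 ≤ ‖a • x - p‖ ^ 2 + 2 := by
  obtain ⟨j, hj⟩ := Finite.exists_max fun i => (a • x - p) i
  refine ⟨j, fun hx hx1 => ?_⟩
  set d := a • x - p with hd
  have h1 : (a + 1) • x - (p + EuclideanSpace.single j (1 : ℝ)) =
      d + (x - EuclideanSpace.single j (1 : ℝ)) := by
    rw [hd, add_smul, one_smul]; abel
  have h2 : inner ℝ d x ≤ d j := by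
    calc inner ℝ d x = ∑ i, d i * x i := by
          simp [PiLp.inner_apply, mul_comm]
      _ ≤ ∑ i, d j * x i := Finset.sum_le_sum fun i _ => mul_le_mul_of_nonneg_right (hj i) (hx i)
      _ = d j := by rw [← Finset.mul_sum, hx1, mul_one]
  have h3 : ‖x‖ ^ 2 ≤ 1 := by
    rw [EuclideanSpace.real_norm_sq_eq, ← hx1]
    refine Finset.sum_le_sum fun i _ => ?_
    have : x i ≤ 1 := hx1 ▸ Finset.single_le_sum (fun i _ => hx i) (Finset.mem_univ i)
    nlinarith [hx i]
  have h4 : inner ℝ d (EuclideanSpace.single j (1 : ℝ)) = d j := by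
    simp [EuclideanSpace.inner_single_right]
  have h5 : inner ℝ x (EuclideanSpace.single j (1 : ℝ)) = x j := by
    simp [EuclideanSpace.inner_single_right]
  have h6 : ‖(EuclideanSpace.single j (1 : ℝ) : EuclideanSpace ℝ (Fin n))‖ = 1 := by simp
  rw [h1, norm_add_sq_real, norm_sub_sq_real x, inner_sub_right, h4, h5, h6]
  linarith [hx j]

/-- The greedy lattice path tracking the ray through `x k` at time `k`. -/
lemma exists_greedy_path {n : ℕ} [Nonempty (Fin n)] (x : ℕ → EuclideanSpace ℝ (Fin n))
    (hx : ∀ k i, 0 ≤ x k i) (hx1 : ∀ k, ∑ i, x k i = 1) :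
    ∃ (j : ℕ → Fin n) (p : ℕ → EuclideanSpace ℝ (Fin n)), p 0 = 0 ∧
      (∀ k, p (k + 1) = p k + EuclideanSpace.single (j k) (1 : ℝ)) ∧
      ∀ k : ℕ, ‖((k : ℝ) + 1) • x k - p (k + 1)‖ ^ 2 ≤ ‖(k : ℝ) • x k - p k‖ ^ 2 + 2 := by
  choose g hg using fun (k : ℕ) (p : EuclideanSpace ℝ (Fin n)) =>
    exists_greedy_step (k : ℝ) (x k) p
  let p : ℕ → EuclideanSpace ℝ (Fin n) := fun k =>
    Nat.rec 0 (fun k q => q + EuclideanSpace.single (g k q) (1 : ℝ)) k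
  exact ⟨fun k => g k (p k), p, rfl, fun k => rfl, fun k => hg k (p k) (hx k) (hx1 k)⟩

lemma tendsto_zero_of_le_half_add {E η : ℕ → ℝ} (hE : ∀ m, 0 ≤ E m)
    (h : ∀ m, E (m + 1) ≤ E m / 2 + η m) (hη : Tendsto η atTop (𝓝 0)) :
    Tendsto E atTop (𝓝 0) := by
  rw [Metric.tendsto_atTop]
  intro ε hε
  obtain ⟨M, hM⟩ := eventually_atTop.1
    (hη.eventually (gt_mem_nhds (show (0 : ℝ) < ε / 4 by linarith)))
  have hind : ∀ r, E (M + r) ≤ E M * (1 / 2) ^ r + ε / 2 := by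
    intro r
    induction r with
    | zero => simp; linarith
    | succ r ih =>
      have h1 := h (M + r)
      have h2 := hM (M + r) (by omega)
      rw [← add_assoc, pow_succ]
      linarith
  have hlim : Tendsto (fun r : ℕ => E M * (1 / 2 : ℝ) ^ r) atTop (𝓝 0) := by
    simpa using (tendsto_pow_atTop_nhds_zero_of_lt_one (r := (1 / 2 : ℝ))
      (by norm_num) (by norm_num)).const_mul (E M)
  obtain ⟨R, hR⟩ := eventually_atTop.1 (hlim.eventually (gt_mem_nhds (half_pos hε)))
  refine ⟨M + R, fun m hm => ?_⟩
  obtain ⟨r, rfl⟩ := Nat.exists_eq_add_of_le hm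
  have h1 := hind (R + r)
  have h2 := hR (R + r) (by omega)
  rw [Real.dist_eq, sub_zero, abs_of_nonneg (hE _), add_assoc]
  linarith

lemma norm_le_add_sqrt {a b g : ℝ} (hg : 0 ≤ g) (h : a ^ 2 ≤ g ^ 2 + b) (hb : 0 ≤ b) :
    a ≤ g + √b := by
  refine le_of_sq_le_sq ?_ (by positivity)
  nlinarith [Real.sq_sqrt hb, Real.sqrt_nonneg b, mul_nonneg hg (Real.sqrt_nonneg b)]

lemma tendsto_natLog_two : Tendsto (Nat.log 2) atTop atTop :=
  tendsto_atTop_atTop.2 fun m => ⟨2 ^ m, fun k hk => by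
    simpa using Nat.log_mono_right (b := 2) hk⟩

lemma tendsto_sqrt_two_div_two_pow :
    Tendsto (fun m : ℕ => √(2 * 2 ^ m) / 2 ^ m) atTop (𝓝 0) := by
  have h : Tendsto (fun m : ℕ => √(2 * (1 / 2 : ℝ) ^ m)) atTop (𝓝 0) := by
    have := ((tendsto_pow_atTop_nhds_zero_of_lt_one (r := (1 / 2 : ℝ))
      (by norm_num) (by norm_num)).const_mul 2).sqrt
    simpa using this
  refine h.congr fun m => ?_
  rw [eq_div_iff (by positivity)]
  refine ((Real.sqrt_eq_iff_mul_self_eq (by positivity) (by positivity)).2 (Eq.symm ?_)).symm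
  have h1 : √(2 * (1 / 2 : ℝ) ^ m) * √(2 * (1 / 2 : ℝ) ^ m) = 2 * (1 / 2 : ℝ) ^ m :=
    Real.mul_self_sqrt (by positivity)
  have h2 : (1 / 2 : ℝ) ^ m * 2 ^ m = 1 := by rw [← mul_pow]; norm_num
  calc _ = √(2 * (1 / 2 : ℝ) ^ m) * √(2 * (1 / 2 : ℝ) ^ m) * (2 ^ m * 2 ^ m) := by ring
    _ = 2 * 2 ^ m * ((1 / 2 : ℝ) ^ m * 2 ^ m) := by rw [h1]; ring
    _ = 2 * 2 ^ m := by rw [h2, mul_one]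

/-- If the targets `y m` move slowly, a greedy path that aims at `y m` during the time interval
`[2 ^ m, 2 ^ (m + 1))` is asymptotic to its targets. -/
lemma tendsto_greedy_error {F : Type*} [NormedAddCommGroup F] [NormedSpace ℝ F]
    {y p : ℕ → F} (hy : Tendsto (fun m => ‖y (m + 1) - y m‖) atTop (𝓝 0))
    (hp : ∀ k : ℕ, ‖((k : ℝ) + 1) • y (Nat.log 2 k) - p (k + 1)‖ ^ 2 ≤
      ‖(k : ℝ) • y (Nat.log 2 k) - p k‖ ^ 2 + 2) :
    Tendsto (fun k : ℕ => ‖(k : ℝ) • y (Nat.log 2 k) - p k‖ / k) atTop (𝓝 0) := by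
  have hblock : ∀ m r : ℕ, r ≤ 2 ^ m →
      ‖((2 ^ m + r : ℕ) : ℝ) • y m - p (2 ^ m + r)‖ ^ 2 ≤
        ‖((2 ^ m : ℕ) : ℝ) • y m - p (2 ^ m)‖ ^ 2 + 2 * r := by
    intro m r
    induction r with
    | zero => simp
    | succ r ih =>
      intro hr
      have h1 := hp (2 ^ m + r)
      have h2 : Nat.log 2 (2 ^ m + r) = m :=
        Nat.log_eq_of_pow_le_of_lt_pow (by omega) (by rw [pow_succ]; omega)
      have h3 := ih (by omega)
      rw [h2] at h1
      have h4 : (((2 ^ m + (r + 1) : ℕ)) : ℝ) = ((2 ^ m + r : ℕ) : ℝ) + 1 := by push_cast; ring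
      rw [h4, ← add_assoc (2 ^ m) r 1]
      push_cast at *
      linarith
  set G : ℕ → ℝ := fun m => ‖((2 ^ m : ℕ) : ℝ) • y m - p (2 ^ m)‖ with hG
  have hG0 : ∀ m, 0 ≤ G m := fun m => norm_nonneg _
  have hblock' : ∀ m r : ℕ, r ≤ 2 ^ m →
      ‖((2 ^ m + r : ℕ) : ℝ) • y m - p (2 ^ m + r)‖ ≤ G m + √(2 * 2 ^ m) := by
    intro m r hr
    refine norm_le_add_sqrt (hG0 m) ((hblock m r hr).trans ?_) (by positivity)
    have : (r : ℝ) ≤ 2 ^ m := by exact_mod_cast hr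
    simp only [hG]
    linarith
  have hE : Tendsto (fun m => G m / 2 ^ m) atTop (𝓝 0) := by
    refine tendsto_zero_of_le_half_add (η := fun m => √(2 * 2 ^ m) / 2 ^ m + ‖y (m + 1) - y m‖)
      (fun m => by have := hG0 m; positivity) (fun m => ?_)
      (by simpa using tendsto_sqrt_two_div_two_pow.add hy)
    have h1 := hblock' m (2 ^ m) le_rfl
    have h2 : 2 ^ m + 2 ^ m = 2 ^ (m + 1) := by ring
    rw [h2] at h1
    have h3 : G (m + 1) ≤ G m + √(2 * 2 ^ m) + 2 ^ (m + 1) * ‖y (m + 1) - y m‖ := by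
      have h4 : ((2 ^ (m + 1) : ℕ) : ℝ) • y (m + 1) - p (2 ^ (m + 1)) =
          (((2 ^ (m + 1) : ℕ) : ℝ) • y m - p (2 ^ (m + 1))) +
            ((2 ^ (m + 1) : ℕ) : ℝ) • (y (m + 1) - y m) := by
        rw [smul_sub]; abel
      have h5 : ‖((2 ^ (m + 1) : ℕ) : ℝ) • (y (m + 1) - y m)‖ =
          2 ^ (m + 1) * ‖y (m + 1) - y m‖ := by
        rw [norm_smul]; simp
      simp only [hG] at h1 ⊢
      rw [h4]
      refine (norm_add_le _ _).trans ?_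
      rw [h5]
      linarith
    have h6 : G m / 2 ^ m / 2 + (√(2 * 2 ^ m) / 2 ^ m + ‖y (m + 1) - y m‖) =
        (G m + 2 * √(2 * 2 ^ m) + 2 ^ (m + 1) * ‖y (m + 1) - y m‖) / 2 ^ (m + 1) := by
      rw [pow_succ]; field_simp; ring
    rw [h6]
    gcongr
    linarith [Real.sqrt_nonneg (2 * 2 ^ m)]
  have hlim := (hE.add tendsto_sqrt_two_div_two_pow).comp tendsto_natLog_two
  rw [add_zero] at hlim
  refine squeeze_zero' (Eventually.of_forall fun k => by positivity) ?_ hlim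
  filter_upwards [eventually_ge_atTop 1] with k hk
  have h1 : 2 ^ Nat.log 2 k ≤ k := Nat.pow_log_le_self 2 (by omega)
  have h2 : k < 2 ^ (Nat.log 2 k + 1) := Nat.lt_pow_succ_log_self (by norm_num) k
  obtain ⟨r, hr⟩ := Nat.exists_eq_add_of_le h1
  have h3 := hblock' (Nat.log 2 k) r (by rw [pow_succ] at h2; omega)
  rw [← hr] at h3
  have h4 : (2 : ℝ) ^ Nat.log 2 k ≤ k := by exact_mod_cast h1
  simp only [Function.comp]
  rw [← add_div]
  have := hG0 (Nat.log 2 k)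
  gcongr

/-- Normalization is controlled by the relative distance to a ray. -/
lemma norm_normalize_sub_le {F : Type*} [NormedAddCommGroup F] [NormedSpace ℝ F]
    (v u : F) (hu : ‖u‖ = 1) {r : ℝ} (hr : 0 < r) :
    ‖‖v‖⁻¹ • v - u‖ ≤ 2 * (‖v - r • u‖ / r) := by
  have hru : ‖r • u‖ = r := by rw [norm_smul, hu, Real.norm_of_nonneg hr.le, mul_one]
  have h1 : r * ‖‖v‖⁻¹ • v - u‖ ≤ 2 * ‖v - r • u‖ := by
    have h2 : r * ‖‖v‖⁻¹ • v - u‖ = ‖(r - ‖v‖) • (‖v‖⁻¹ • v) + (v - r • u)‖ := by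
      rw [← Real.norm_of_nonneg hr.le, ← norm_smul, Real.norm_of_nonneg hr.le]
      congr 1
      rcases eq_or_ne v 0 with rfl | hv
      · simp
      · rw [sub_smul, smul_inv_smul₀ (norm_ne_zero_iff.2 hv), smul_sub]; abel
    have h3 : ‖‖v‖⁻¹ • v‖ ≤ 1 := by
      rw [norm_smul, norm_inv, norm_norm]
      exact inv_mul_le_one
    have h4 : |r - ‖v‖| ≤ ‖v - r • u‖ := by
      have := abs_norm_sub_norm_le (r • u) v
      rwa [hru, norm_sub_rev] at this
    rw [h2]
    refine (norm_add_le _ _).trans ?_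
    rw [norm_smul, Real.norm_eq_abs]
    nlinarith [norm_nonneg (‖v‖⁻¹ • v), abs_nonneg (r - ‖v‖)]
  rw [← mul_div_assoc, le_div_iff₀ hr]
  linarith

/-- Adding up basis vectors gives a walk. -/
lemma exists_walk_of_steps {n m : ℕ} (v : Fin m → EuclideanSpace ℝ (Fin n)) (j : ℕ → Fin m)
    (p : ℕ → EuclideanSpace ℝ (Fin n)) (hp : ∀ k, p (k + 1) = p k + v (j k)) :
    IsWalk v fun t => p ⌊t⌋₊ + (t - ⌊t⌋₊) • v (j ⌊t⌋₊) := by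
  refine ⟨j, fun k t ht => ?_⟩
  rcases ht.2.lt_or_eq with h | h
  · have : ⌊t⌋₊ = k := (Nat.floor_eq_iff (k.cast_nonneg.trans ht.1)).2 ⟨ht.1, h⟩
    simp [this]
  · have : ⌊t⌋₊ = k + 1 := by rw [h]; exact_mod_cast Nat.floor_natCast (k + 1)
    simp only [this, Nat.floor_natCast, hp]
    simp [h]

/-- A path whose direction is asymptotic to a fine sampling of `γ` has the limit set of `γ` as its
radial limit set. -/
lemma radialLimitSet_eq_of_tendsto {n : ℕ} {c γ : ℝ → EuclideanSpace ℝ (Fin n)} {s : ℕ → ℝ}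
    (hmono : Monotone s) (hs : Tendsto s atTop atTop)
    (hosc : ∀ ε > 0, ∀ᶠ m in atTop, ∀ t ∈ Set.Icc (s m) (s (m + 1)), dist (γ t) (γ (s m)) < ε)
    (hc : Tendsto (fun t : ℝ => ‖‖c t‖⁻¹ • c t - γ (s (Nat.log 2 ⌊t⌋₊))‖) atTop (𝓝 0)) :
    radialLimitSet c = ⋂ T ∈ Set.Ioi (0 : ℝ), closure (γ '' Set.Ici T) := by
  have hlog : Tendsto (fun t : ℝ => s (Nat.log 2 ⌊t⌋₊)) atTop atTop :=
    hs.comp (tendsto_natLog_two.comp tendsto_nat_floor_atTop)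
  apply Set.Subset.antisymm
  · rintro q ⟨a, -, ha, haq⟩
    have h1 : Tendsto (fun k => γ (s (Nat.log 2 ⌊a k⌋₊))) atTop (𝓝 q) := by
      have := haq.sub (tendsto_zero_iff_norm_tendsto_zero.2 (hc.comp ha))
      simpa using this
    simp only [Set.mem_iInter]
    intro T _
    refine mem_closure_of_tendsto h1 ?_
    filter_upwards [(hlog.comp ha).eventually_ge_atTop T] with k hk
    exact ⟨_, hk, rfl⟩
  · intro q hq
    have key : ∀ k : ℕ, ∃ a : ℝ, (k : ℝ) ≤ a ∧
        dist (‖c a‖⁻¹ • c a) q < 1 / ((k : ℝ) + 1) := by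
      intro k
      set ε : ℝ := 1 / ((k : ℝ) + 1) with hε
      have hε0 : 0 < ε / 3 := by positivity
      have hpow : Tendsto (fun m : ℕ => (2 : ℝ) ^ m) atTop atTop :=
        tendsto_pow_atTop_atTop_of_one_lt (by norm_num)
      obtain ⟨M, hM⟩ := eventually_atTop.1 (((hpow.eventually_ge_atTop (k : ℝ)).and
        (hpow.eventually (hc.eventually (gt_mem_nhds hε0)))).and
        ((hosc _ hε0).and (hs.eventually_gt_atTop 0)))
      have hq' := Set.mem_iInter₂.1 hq (s M) (hM M le_rfl).2.2
      obtain ⟨_, ⟨t, ht, rfl⟩, htq⟩ := Metric.mem_closure_iff.1 hq' _ hε0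
      have hex : ∃ m, t < s (m + 1) :=
        ((hs.comp (tendsto_add_atTop_nat 1)).eventually_gt_atTop t).exists
      classical
      have hlt := Nat.find_spec hex
      have hle : s (Nat.find hex) ≤ t := by
        rcases hm : Nat.find hex with _ | m
        · exact (hmono (Nat.zero_le M)).trans ht
        · have := Nat.find_min hex (m := m) (by omega)
          exact not_lt.1 this
      set m := Nat.find hex
      have hMm : M ≤ m := by
        by_contra! hlt'
        have := hmono (show m + 1 ≤ M by omega)
        have ht' : s M ≤ t := ht
        linarith
      obtain ⟨⟨h1, h2⟩, h3, -⟩ := hM m hMm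
      have h4 : Nat.log 2 ⌊(2 : ℝ) ^ m⌋₊ = m := by
        have : ⌊(2 : ℝ) ^ m⌋₊ = 2 ^ m := by exact_mod_cast Nat.floor_natCast (R := ℝ) (2 ^ m)
        rw [this, Nat.log_pow (by norm_num)]
      rw [h4, ← dist_eq_norm] at h2
      refine ⟨2 ^ m, h1, ?_⟩
      have h5 := h3 t ⟨hle, hlt.le⟩
      have h6 := dist_triangle4 (‖c (2 ^ m)‖⁻¹ • c (2 ^ m)) (γ (s m)) (γ t) q
      rw [dist_comm (γ (s m)), dist_comm (γ t) q] at h6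
      linarith
    choose a ha haq using key
    refine ⟨a, fun k => k.cast_nonneg.trans (ha k),
      tendsto_atTop_mono ha tendsto_natCast_atTop_atTop, ?_⟩
    exact tendsto_iff_dist_tendsto_zero.2 (squeeze_zero (fun _ => dist_nonneg)
      (fun k => (haq k).le) tendsto_one_div_add_atTop_nhds_zero_nat)

/-- The coordinate sum of a nonnegative unit vector lies between `1` and `n`. -/
lemma sum_coord_bounds {n : ℕ} {u : EuclideanSpace ℝ (Fin n)} (hu : ‖u‖ = 1)
    (h0 : ∀ i, 0 ≤ u i) : 0 < ∑ i, u i ∧ ∑ i, u i ≤ n := by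
  constructor
  · refine (Finset.sum_nonneg fun i _ => h0 i).lt_of_ne fun h => ?_
    have h1 := (Finset.sum_eq_zero_iff_of_nonneg fun i _ => h0 i).1 h.symm
    have h2 : u = 0 := by ext i; simpa using h1 i (Finset.mem_univ i)
    simp [h2] at hu
  · calc ∑ i, u i ≤ ∑ _i : Fin n, (1 : ℝ) := Finset.sum_le_sum fun i _ => by
          have := PiLp.norm_apply_le u i
          rw [hu, Real.norm_eq_abs] at this
          exact (le_abs_self _).trans this
      _ = n := by simp

/-- Let `L ⊂ ℝ^n` be the set of nonnegative unit vectors and let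
`γ : [0,∞) → L` be a continuous path.  Then there is a walk `c` over the standard basis
vectors, starting at the origin, with `‖c t‖ → ∞`, whose radial limit set equals
`⋂_{T>0} closure (γ([T,∞)))`. -/
theorem stmt2 (n : ℕ) (hn : 1 ≤ n)
    (L : Set (EuclideanSpace ℝ (Fin n)))
    (hL : L = {y : EuclideanSpace ℝ (Fin n) | ‖y‖ = 1 ∧ ∀ i, 0 ≤ y i})
    (γ : ℝ → EuclideanSpace ℝ (Fin n))
    (hγc : ContinuousOn γ (Set.Ici 0))
    (hγL : ∀ t : ℝ, 0 ≤ t → γ t ∈ L) :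
    ∃ c : ℝ → EuclideanSpace ℝ (Fin n),
      IsWalk (fun i : Fin n => EuclideanSpace.single i (1 : ℝ)) c ∧ c 0 = 0 ∧
      Tendsto (fun t => ‖c t‖) atTop atTop ∧
      radialLimitSet c = ⋂ T ∈ Set.Ioi (0 : ℝ), closure (γ '' Set.Ici T) := by
  subst hL
  have : Nonempty (Fin n) := ⟨⟨0, hn⟩⟩
  have hn0 : (0 : ℝ) < n := by exact_mod_cast hn
  have hS : ∀ t, 0 ≤ t → 0 < ∑ i, γ t i ∧ ∑ i, γ t i ≤ n := fun t ht =>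
    sum_coord_bounds (hγL t ht).1 (hγL t ht).2
  have hSc : ContinuousOn (fun t => (∑ i, γ t i)⁻¹) (Set.Ici 0) := by
    refine ContinuousOn.inv₀ (continuousOn_finsetSum _ fun i _ => ?_) fun t ht => (hS t ht).1.ne'
    exact (EuclideanSpace.proj (𝕜 := ℝ) i).continuous.comp_continuousOn hγc
  obtain ⟨s, hs0, hmono, hs, hosc⟩ := exists_sampling (hγc.prodMk (hSc.smul hγc))
  have hsn : ∀ m, 0 ≤ s m := fun m => hs0 ▸ hmono (Nat.zero_le m)
  let w : ℕ → ℝ := fun m => (∑ i, γ (s m) i)⁻¹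
  let y : ℕ → EuclideanSpace ℝ (Fin n) := fun m => w m • γ (s m)
  have hw0 : ∀ m, 0 < w m := fun m => inv_pos.2 (hS _ (hsn m)).1
  have hw : ∀ m, 1 / (n : ℝ) ≤ w m := fun m => by
    rw [one_div]; exact inv_anti₀ (hS _ (hsn m)).1 (hS _ (hsn m)).2
  have hy0 : ∀ m i, 0 ≤ y m i := fun m i => mul_nonneg (hw0 m).le ((hγL _ (hsn m)).2 i)
  have hy1 : ∀ m, ∑ i, y m i = 1 := fun m => by
    simp only [y, PiLp.smul_apply, smul_eq_mul]
    rw [← Finset.mul_sum]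
    exact inv_mul_cancel₀ (hS _ (hsn m)).1.ne'
  have hyn : ∀ m, ‖y m‖ = w m := fun m => by
    rw [norm_smul, (hγL _ (hsn m)).1, Real.norm_of_nonneg (hw0 m).le, mul_one]
  have hy : Tendsto (fun m => ‖y (m + 1) - y m‖) atTop (𝓝 0) := by
    refine Metric.tendsto_nhds.2 fun ε hε => ?_
    filter_upwards [hosc ε hε] with m hm
    have h1 := hm (s (m + 1)) ⟨hmono m.le_succ, le_rfl⟩
    rw [Real.dist_0_eq_abs, abs_norm, ← dist_eq_norm]
    exact (le_max_right _ _).trans_lt h1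
  obtain ⟨j, p, hp0, hp, hpx⟩ := exists_greedy_path (fun k => y (Nat.log 2 k))
    (fun k => hy0 _) fun k => hy1 _
  have herr := tendsto_greedy_error hy hpx
  set e : Fin n → EuclideanSpace ℝ (Fin n) := fun i => EuclideanSpace.single i (1 : ℝ) with he
  set c : ℝ → EuclideanSpace ℝ (Fin n) := fun t => p ⌊t⌋₊ + (t - ⌊t⌋₊) • e (j ⌊t⌋₊) with hcdef
  have hy_le : ∀ m, ‖y m‖ ≤ 1 := fun m => by
    have h1 : ‖y m‖ = ‖∑ i, y m i • e i‖ := by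
      congr 1; ext i; simp [he, Pi.single_apply]
    rw [h1, ← hy1 m]
    refine (norm_sum_le _ _).trans (Finset.sum_le_sum fun i _ => ?_)
    rw [norm_smul, Real.norm_of_nonneg (hy0 m i)]
    simp [he]
  let A : ℝ → ℝ := fun t => ‖c t - t • y (Nat.log 2 ⌊t⌋₊)‖ / t
  have hA : Tendsto A atTop (𝓝 0) := by
    have hlim := (herr.add (tendsto_const_div_atTop_nhds_zero_nat (2 : ℝ))).comp
      (tendsto_nat_floor_atTop (α := ℝ))
    rw [add_zero] at hlim
    refine squeeze_zero' ?_ ?_ hlim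
    · filter_upwards [eventually_ge_atTop 0] with t ht
      exact div_nonneg (norm_nonneg _) ht
    · filter_upwards [eventually_ge_atTop 1] with t ht
      have ht0 : (0 : ℝ) ≤ t := by linarith
      have h1 : (⌊t⌋₊ : ℝ) ≤ t := Nat.floor_le ht0
      have h2 := Nat.lt_floor_add_one t
      have h3 : (0 : ℝ) < ⌊t⌋₊ := by exact_mod_cast Nat.floor_pos.2 ht
      simp only [Function.comp, A]
      rw [← add_div]
      set k := ⌊t⌋₊
      have h4 : c t - t • y (Nat.log 2 k) = -((k : ℝ) • y (Nat.log 2 k) - p k) +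
          (t - k) • (e (j k) - y (Nat.log 2 k)) := by
        simp only [hcdef, smul_sub, sub_smul]
        abel
      have h5 : ‖(t - k) • (e (j k) - y (Nat.log 2 k))‖ ≤ 2 := by
        rw [norm_smul, Real.norm_of_nonneg (by linarith)]
        have h6 := norm_sub_le (e (j k)) (y (Nat.log 2 k))
        have h7 : ‖e (j k)‖ = 1 := by simp [he]
        have h8 := hy_le (Nat.log 2 k)
        nlinarith [norm_nonneg (e (j k) - y (Nat.log 2 k))]
      have h9 : ‖c t - t • y (Nat.log 2 k)‖ ≤ ‖(k : ℝ) • y (Nat.log 2 k) - p k‖ + 2 := by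
        rw [h4]
        refine (norm_add_le _ _).trans ?_
        rw [norm_neg]
        linarith
      gcongr
  refine ⟨c, exists_walk_of_steps e j p hp, by simp [hcdef, hp0], ?_, ?_⟩
  · have hlin : Tendsto (fun t : ℝ => 1 / (2 * (n : ℝ)) * t) atTop atTop :=
      tendsto_id.const_mul_atTop (by positivity)
    refine tendsto_atTop_mono' _ ?_ hlin
    filter_upwards [hA.eventually (gt_mem_nhds (show (0 : ℝ) < 1 / (2 * n) by positivity)),
      eventually_gt_atTop 0] with t h1 ht
    rw [div_lt_iff₀ ht] at h1
    have h2 := norm_sub_norm_le (t • y (Nat.log 2 ⌊t⌋₊)) (c t)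
    rw [norm_sub_rev, norm_smul, Real.norm_of_nonneg ht.le, hyn] at h2
    have h3 := mul_le_mul_of_nonneg_left (hw (Nat.log 2 ⌊t⌋₊)) ht.le
    have h4 : t * (1 / (n : ℝ)) = 2 * (1 / (2 * (n : ℝ)) * t) := by field_simp
    linarith
  · refine radialLimitSet_eq_of_tendsto hmono hs (fun ε hε => ?_) ?_
    · filter_upwards [hosc ε hε] with m hm t ht
      exact (le_max_left _ _).trans_lt (hm t ht)
    · have hlim : Tendsto (fun t => 2 * n * A t) atTop (𝓝 0) := by
        simpa using hA.const_mul (2 * (n : ℝ))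
      refine squeeze_zero' (Eventually.of_forall fun t => norm_nonneg _) ?_ hlim
      filter_upwards [eventually_gt_atTop 0] with t ht
      set m := Nat.log 2 ⌊t⌋₊ with hm
      refine (norm_normalize_sub_le (c t) (γ (s m)) (hγL _ (hsn m)).1
        (mul_pos ht (hw0 m))).trans ?_
      have h1 : (1 : ℝ) ≤ n * w m := by
        have := mul_le_mul_of_nonneg_left (hw m) hn0.le
        rwa [mul_one_div_cancel hn0.ne'] at this
      rw [mul_smul, mul_assoc]
      refine mul_le_mul_of_nonneg_left ?_ zero_le_two
      rw [div_le_iff₀ (mul_pos ht (hw0 m))]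
      have h2 : n * A t * (t * w m) = ‖c t - t • y m‖ * (n * w m) := by
        simp only [A, ← hm]; field_simp
      rw [h2]
      exact le_mul_of_one_le_right (norm_nonneg _) h1
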